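/- arXiv:1806.10357 — 2 statements merged into one kernel-verified Lean document; each statement's English description precedes it below -/
import Mathlib

section
/- Let n ≥ 2 and let j be an integer with 1 ≤ j ≤ n−1 and 2j not divisible by n. Under the uniform probability measure on {−1,1}^n, the variance of |f_j|² equals n² − 2n. -/
open Finset Real

/-- Expectation with respect to the uniform probability measure on `{-1,1}^n`:
`E[g] = 2^{-n} ∑_{x ∈ {-1,1}^n} g(x)`. -/
noncomputable def expect (n : ℕ) (g : (Fin n → ℝ) → ℝ) : ℝ :=
  (∑ x : Fin n → ({-1, 1} : Finset ℝ), g (fun k => (x k : ℝ))) / 2 ^ n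

/-- Variance with respect to the uniform probability measure on `{-1,1}^n`:
`V[g] = E[g²] − E[g]²`. -/
noncomputable def var (n : ℕ) (g : (Fin n → ℝ) → ℝ) : ℝ :=
  expect n (fun x => g x ^ 2) - (expect n g) ^ 2

/-- The squared amplitude of the `j`-th discrete Fourier coefficient:
`|f_j|² = (∑_k x_k cos(2πkj/n))² + (∑_k x_k sin(2πkj/n))²`. -/
noncomputable def absSqDFT (n : ℕ) (j : ℕ) (x : Fin n → ℝ) : ℝ :=
  (∑ k : Fin n, x k * Real.cos (2 * Real.pi * k * j / n)) ^ 2 +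
    (∑ k : Fin n, x k * Real.sin (2 * Real.pi * k * j / n)) ^ 2

lemma expect_add' (n : ℕ) (g h : (Fin n → ℝ) → ℝ) :
    _root_.expect n (fun x => g x + h x) = _root_.expect n g + _root_.expect n h := by
  simp only [_root_.expect, Finset.sum_add_distrib, add_div]

lemma expect_smul' (n : ℕ) (c : ℝ) (g : (Fin n → ℝ) → ℝ) :
    _root_.expect n (fun x => c * g x) = c * _root_.expect n g := by
  simp only [_root_.expect, ← Finset.mul_sum, mul_div_assoc]

lemma expect_const' (n : ℕ) (c : ℝ) : _root_.expect n (fun _ => c) = c := by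
  have h : Fintype.card (({-1, 1} : Finset ℝ)) = 2 := by
    rw [Fintype.card_coe, Finset.card_pair (by norm_num)]
  simp only [_root_.expect, Finset.sum_const, Finset.card_univ, Fintype.card_fun, h, Fintype.card_fin]
  simp

lemma expect_succ' (n : ℕ) (g : (Fin (n+1) → ℝ) → ℝ) :
    _root_.expect (n+1) g = _root_.expect n (fun x => (g (Fin.cons 1 x) + g (Fin.cons (-1) x)) / 2) := by
  unfold _root_.expect
  have e : ∑ x : Fin (n+1) → ({-1, 1} : Finset ℝ), g (fun k => (x k : ℝ))
      = ∑ p : ({-1, 1} : Finset ℝ) × (Fin n → ({-1, 1} : Finset ℝ)),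
          g (Fin.cons (p.1 : ℝ) (fun k => (p.2 k : ℝ))) := by
    refine (Fintype.sum_equiv (Fin.consEquiv (fun _ => ({-1, 1} : Finset ℝ))) _ _ ?_).symm
    rintro ⟨a, x⟩
    congr 1
    funext k
    refine Fin.cases ?_ (fun i => ?_) k <;> simp [Fin.consEquiv]
  rw [e, Fintype.sum_prod_type_right, ← Finset.sum_div, pow_succ']
  have : ∀ y : Fin n → ({-1, 1} : Finset ℝ),
      ∑ x : ({-1, 1} : Finset ℝ), g (Fin.cons (x : ℝ) (fun k => (y k : ℝ)))
      = g (Fin.cons 1 (fun k => (y k : ℝ))) + g (Fin.cons (-1) (fun k => (y k : ℝ))) := by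
    intro y
    rw [Finset.sum_coe_sort ({-1, 1} : Finset ℝ) (fun x => g (Fin.cons x (fun k => (y k : ℝ)))),
      Finset.sum_pair (by norm_num), add_comm]
  simp only [this]
  field_simp

lemma expect_two (n : ℕ) (a b : Fin n → ℝ) :
    _root_.expect n (fun x => (∑ k, x k * a k) * (∑ k, x k * b k)) = ∑ k, a k * b k := by
  induction n with
  | zero => simp [expect_const']
  | succ n ih =>
    rw [expect_succ', Fin.sum_univ_succ, ← ih (fun i => a i.succ) (fun i => b i.succ)]
    rw [← expect_const' n (a 0 * b 0), ← expect_add']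
    congr 1
    funext x
    simp only [Fin.sum_univ_succ, Fin.cons_zero, Fin.cons_succ, expect_const']
    ring

lemma expect_four (n : ℕ) (a b : Fin n → ℝ) :
    _root_.expect n (fun x => (∑ k, x k * a k) ^ 2 * (∑ k, x k * b k) ^ 2)
      = (∑ k, a k ^ 2) * (∑ k, b k ^ 2) + 2 * (∑ k, a k * b k) ^ 2
        - 2 * ∑ k, a k ^ 2 * b k ^ 2 := by
  induction n with
  | zero => simp [expect_const']
  | succ n ih =>
    have h := ih (fun i => a i.succ) (fun i => b i.succ)
    have h1 := expect_two n (fun i => a i.succ) (fun i => b i.succ)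
    have h2 := expect_two n (fun i => a i.succ) (fun i => a i.succ)
    have h3 := expect_two n (fun i => b i.succ) (fun i => b i.succ)
    rw [expect_succ']
    have : (fun x : Fin n → ℝ =>
        ((fun x : Fin (n+1) → ℝ => (∑ k, x k * a k) ^ 2 * (∑ k, x k * b k) ^ 2) (Fin.cons 1 x)
        + (fun x : Fin (n+1) → ℝ => (∑ k, x k * a k) ^ 2 * (∑ k, x k * b k) ^ 2)
          (Fin.cons (-1) x)) / 2)
      = fun x => (∑ k, x k * a k.succ) ^ 2 * (∑ k, x k * b k.succ) ^ 2
        + (4 * (a 0 * b 0) * ((∑ k, x k * a k.succ) * (∑ k, x k * b k.succ))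
        + (b 0 ^ 2 * ((∑ k, x k * a k.succ) * (∑ k, x k * a k.succ))
        + (a 0 ^ 2 * ((∑ k, x k * b k.succ) * (∑ k, x k * b k.succ))
        + a 0 ^ 2 * b 0 ^ 2))) := by
      funext x
      simp only [Fin.sum_univ_succ, Fin.cons_zero, Fin.cons_succ]
      ring
    simp only [] at this
    rw [this]
    simp only [expect_add', expect_smul', expect_const', h, h1, h2, h3]
    simp only [Fin.sum_univ_succ, ← pow_two]
    ring

lemma trig_sums (n : ℕ) (hn : 2 ≤ n) (j : ℕ) (hj3 : ¬ (n ∣ 2 * j)) :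
    ∑ k : Fin n, Real.cos (2 * (2 * Real.pi * k * j / n)) = 0 ∧
    ∑ k : Fin n, Real.sin (2 * (2 * Real.pi * k * j / n)) = 0 := by
  have hn0 : (n : ℂ) ≠ 0 := by exact_mod_cast (by omega : n ≠ 0)
  set w : ℂ := Complex.exp (2 * (2 * Real.pi * j / n) * Complex.I) with hw
  have hwn : w ^ n = 1 := by
    rw [hw, ← Complex.exp_nat_mul, Complex.exp_eq_one_iff]
    refine ⟨2 * j, ?_⟩
    push_cast
    field_simp
  have hw1 : w ≠ 1 := by
    intro h
    rw [hw, Complex.exp_eq_one_iff] at h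
    obtain ⟨m, hm⟩ := h
    have hpi : (Real.pi : ℂ) ≠ 0 := by exact_mod_cast Real.pi_ne_zero
    have hI := Complex.I_ne_zero
    have h2 : (2 * j : ℂ) = n * m := by
      field_simp at hm
      linear_combination hm
    have h3 : (2 * j : ℤ) = n * m := by exact_mod_cast h2
    apply hj3
    have : (n : ℤ) ∣ ((2 * j : ℕ) : ℤ) := ⟨m, by push_cast; exact h3⟩
    exact_mod_cast this
  have hs : ∑ k : Fin n, w ^ (k : ℕ) = 0 := by
    rw [Fin.sum_univ_eq_sum_range (fun k => w ^ k) n, geom_sum_eq hw1, hwn]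
    simp
  have hk : ∀ k : Fin n, w ^ (k : ℕ) =
      Complex.exp (((2 * (2 * Real.pi * k * j / n) : ℝ) : ℂ) * Complex.I) := by
    intro k
    rw [hw, ← Complex.exp_nat_mul]
    congr 1
    push_cast
    ring
  simp only [hk] at hs
  constructor
  · have := congrArg Complex.re hs
    simpa only [Complex.re_sum, Complex.exp_ofReal_mul_I_re, Complex.zero_re] using this
  · have := congrArg Complex.im hs
    simpa only [Complex.im_sum, Complex.exp_ofReal_mul_I_im, Complex.zero_im] using this

/-- For `1 ≤ j ≤ n-1` with `n ∤ 2j`, the variance of `|f_j|²` under the uniform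
measure on `{-1,1}^n` equals `n² − 2n`. -/
theorem variance_fj_sq (n : ℕ) (hn : 2 ≤ n) (j : ℕ) (hj1 : 1 ≤ j) (hj2 : j ≤ n - 1)
    (hj3 : ¬ (n ∣ 2 * j)) :
    var n (absSqDFT n j) = (n : ℝ) ^ 2 - 2 * n := by
  obtain ⟨hc, hs⟩ := trig_sums n hn j hj3
  set θ : Fin n → ℝ := fun k => 2 * Real.pi * k * j / n with hθ
  set a : Fin n → ℝ := fun k => Real.cos (θ k) with ha
  set b : Fin n → ℝ := fun k => Real.sin (θ k) with hb
  have hone : ∀ k, a k ^ 2 + b k ^ 2 = 1 := fun k => Real.cos_sq_add_sin_sq (θ k)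
  have haa : ∑ k, a k ^ 2 = n / 2 := by
    have : ∀ k, a k ^ 2 = 1 / 2 + Real.cos (2 * (2 * Real.pi * k * j / n)) / 2 :=
      fun k => Real.cos_sq (θ k)
    simp only [this, Finset.sum_add_distrib, ← Finset.sum_div, hc]
    simp
  have hbb : ∑ k, b k ^ 2 = n / 2 := by
    have : ∀ k, b k ^ 2 = 1 - a k ^ 2 := fun k => by linarith [hone k]
    simp only [this, Finset.sum_sub_distrib, haa]
    simp
    ring
  have hab : ∑ k, a k * b k = 0 := by
    have : ∀ k, a k * b k = Real.sin (2 * (2 * Real.pi * k * j / n)) / 2 := fun k => by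
      have := Real.sin_two_mul (θ k)
      simp only [ha, hb]
      simp only [hθ] at this ⊢
      linarith
    simp only [this, ← Finset.sum_div, hs]
    simp
  have hquart : ∑ k, a k ^ 2 * a k ^ 2 + 2 * ∑ k, a k ^ 2 * b k ^ 2 + ∑ k, b k ^ 2 * b k ^ 2
      = n := by
    rw [Finset.mul_sum, ← Finset.sum_add_distrib, ← Finset.sum_add_distrib]
    have : ∀ k, a k ^ 2 * a k ^ 2 + 2 * (a k ^ 2 * b k ^ 2) + b k ^ 2 * b k ^ 2 = 1 := fun k => by
      have : a k ^ 2 * a k ^ 2 + 2 * (a k ^ 2 * b k ^ 2) + b k ^ 2 * b k ^ 2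
        = (a k ^ 2 + b k ^ 2) ^ 2 := by ring
      rw [this, hone, one_pow]
    simp only [this]
    simp
  have e1 : absSqDFT n j = fun x => (∑ k, x k * a k) * (∑ k, x k * a k)
      + (∑ k, x k * b k) * (∑ k, x k * b k) := by
    funext x
    simp only [absSqDFT, ha, hb, hθ]
    ring
  have e2 : (fun x => absSqDFT n j x ^ 2) = fun x =>
      (∑ k, x k * a k) ^ 2 * (∑ k, x k * a k) ^ 2
      + (2 * ((∑ k, x k * a k) ^ 2 * (∑ k, x k * b k) ^ 2)
      + (∑ k, x k * b k) ^ 2 * (∑ k, x k * b k) ^ 2) := by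
    funext x
    rw [e1]
    ring
  unfold var
  rw [e2, e1]
  simp only [expect_add', expect_smul', expect_two, expect_four]
  simp only [hab, ← pow_two, haa, hbb]
  simp only [← pow_two] at hquart
  linear_combination (-2) * hquart
end

section
/- Let R be a fixed positive integer, and for each n ≥ 1 and x ∈ {−1,1}^n define s_r(x) = √(2/n)·∑_{k=0}^{n−1} x_k sin(2πkr/n) and c_r(x) = √(2/n)·∑_{k=0}^{n−1} x_k cos(2πkr/n) for r = 1, …, R, and let φ_n(u_1, v_1, …, u_R, v_R) = E[exp(i·∑_{r=1}^{R}(u_r s_r + v_r c_r))] under the uniform probability measure on {−1,1}^n. Then for every fixed (u_1, v_1, …, u_R, v_R) ∈ ℝ^{2R}, lim_{n→∞} φ_n(u_1, v_1, …, u_R, v_R) = ∏_{r=1}^{R} exp(−u_r²/2)·exp(−v_r²/2). -/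
open Finset Real Complex Filter

/-- `s_r(x) = √(2/n)·∑_{k=0}^{n-1} x_k sin(2πkr/n)`. -/
noncomputable def sCoef (n : ℕ) (x : Fin n → ℝ) (r : ℕ) : ℝ :=
  Real.sqrt (2 / n) * ∑ k : Fin n, x k * Real.sin (2 * Real.pi * k * r / n)

/-- `c_r(x) = √(2/n)·∑_{k=0}^{n-1} x_k cos(2πkr/n)`. -/
noncomputable def cCoef (n : ℕ) (x : Fin n → ℝ) (r : ℕ) : ℝ :=
  Real.sqrt (2 / n) * ∑ k : Fin n, x k * Real.cos (2 * Real.pi * k * r / n)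

/-- The joint characteristic function `φ_n` of `(s_1,c_1,…,s_R,c_R)` under the
uniform probability measure on `{-1,1}^n`. -/
noncomputable def phi (R n : ℕ) (u v : ℕ → ℝ) : ℂ :=
  (∑ x : Fin n → ({-1, 1} : Finset ℝ),
      Complex.exp (Complex.I *
        (∑ r ∈ Finset.Icc 1 R,
          (u r * sCoef n (fun k => (x k : ℝ)) r +
            v r * cCoef n (fun k => (x k : ℝ)) r) : ℝ))) / 2 ^ n

lemma sum_exp_aux (n : ℕ) (m : ℤ) (hn : 0 < n) (hm : ¬ ((n : ℤ) ∣ m)) :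
    ∑ k ∈ Finset.range n, Complex.exp (((2 * Real.pi * k * m / n : ℝ) : ℂ) * Complex.I) = 0 := by
  have hn0 : (n : ℂ) ≠ 0 := by exact_mod_cast hn.ne'
  set z : ℂ := Complex.exp (2 * Real.pi * Complex.I * (m / n)) with hz
  have h1 : ∀ k : ℕ, Complex.exp (((2 * Real.pi * k * m / n : ℝ) : ℂ) * Complex.I) = z ^ k := by
    intro k
    rw [hz, ← Complex.exp_nat_mul]
    congr 1
    push_cast
    ring
  simp_rw [h1]
  have hzn : z ^ n = 1 := by
    rw [hz, ← Complex.exp_nat_mul, Complex.exp_eq_one_iff]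
    refine ⟨m, ?_⟩
    field_simp
  have hz1 : z ≠ 1 := by
    intro h
    rw [hz, Complex.exp_eq_one_iff] at h
    obtain ⟨q, hq⟩ := h
    apply hm
    refine ⟨q, ?_⟩
    have h2 : (2 * Real.pi * Complex.I : ℂ) ≠ 0 := Complex.two_pi_I_ne_zero
    have h3 : (m / n : ℂ) = q := by
      apply mul_left_cancel₀ h2
      rw [hq]; ring
    rw [div_eq_iff hn0] at h3
    have h4 : m = q * n := by exact_mod_cast h3
    rw [h4]; ring
  rw [geom_sum_eq hz1, hzn]; simp

lemma sum_cos_aux (n : ℕ) (m : ℤ) (hn : 0 < n) (hm : ¬ ((n : ℤ) ∣ m)) :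
    ∑ k ∈ Finset.range n, Real.cos (2 * Real.pi * k * m / n) = 0 := by
  have h := congrArg Complex.re (sum_exp_aux n m hn hm)
  rw [Complex.re_sum] at h
  simpa only [Complex.exp_ofReal_mul_I_re, Complex.zero_re] using h

lemma sum_sin_aux (n : ℕ) (m : ℤ) (hn : 0 < n) (hm : ¬ ((n : ℤ) ∣ m)) :
    ∑ k ∈ Finset.range n, Real.sin (2 * Real.pi * k * m / n) = 0 := by
  have h := congrArg Complex.im (sum_exp_aux n m hn hm)
  rw [Complex.im_sum] at h
  simpa only [Complex.exp_ofReal_mul_I_im, Complex.zero_im] using h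

/-- The linear form at frequency index `k`. -/
noncomputable def tAux (R n : ℕ) (u v : ℕ → ℝ) (k : ℕ) : ℝ :=
  ∑ r ∈ Finset.Icc 1 R, (u r * Real.sin (2 * Real.pi * k * r / n) +
    v r * Real.cos (2 * Real.pi * k * r / n))

lemma pair_sum (n r s : ℕ) (a b c d : ℝ) (hr : 1 ≤ r) (hs : 1 ≤ s) (hn : r + s < n) :
    ∑ k ∈ Finset.range n, (a * Real.sin (2 * Real.pi * k * r / n) +
      b * Real.cos (2 * Real.pi * k * r / n)) * (c * Real.sin (2 * Real.pi * k * s / n) +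
      d * Real.cos (2 * Real.pi * k * s / n)) = if r = s then n / 2 * (a * c + b * d) else 0 := by
  have hn0 : 0 < n := by omega
  have hp : ¬ ((n : ℤ) ∣ ((r : ℤ) + s)) := by
    intro h
    have := Int.le_of_dvd (by omega) h
    omega
  have key : ∀ k : ℕ, (a * Real.sin (2 * Real.pi * k * r / n) +
      b * Real.cos (2 * Real.pi * k * r / n)) * (c * Real.sin (2 * Real.pi * k * s / n) +
      d * Real.cos (2 * Real.pi * k * s / n)) =
      (b * d - a * c) / 2 * Real.cos (2 * Real.pi * k * ((r : ℤ) + s : ℤ) / n) +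
      (a * d + b * c) / 2 * Real.sin (2 * Real.pi * k * ((r : ℤ) + s : ℤ) / n) +
      ((a * c + b * d) / 2 * Real.cos (2 * Real.pi * k * ((r : ℤ) - s : ℤ) / n) +
      (a * d - b * c) / 2 * Real.sin (2 * Real.pi * k * ((r : ℤ) - s : ℤ) / n)) := by
    intro k
    have e1 : 2 * Real.pi * k * ((r : ℤ) + s : ℤ) / n =
      2 * Real.pi * k * r / n + 2 * Real.pi * k * s / n := by push_cast; ring
    have e2 : 2 * Real.pi * k * ((r : ℤ) - s : ℤ) / n =
      2 * Real.pi * k * r / n - 2 * Real.pi * k * s / n := by push_cast; ring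
    rw [e1, e2, Real.cos_add, Real.sin_add, Real.cos_sub, Real.sin_sub]
    ring
  simp_rw [key]
  rw [Finset.sum_add_distrib, Finset.sum_add_distrib, Finset.sum_add_distrib,
    ← Finset.mul_sum, ← Finset.mul_sum, ← Finset.mul_sum, ← Finset.mul_sum,
    sum_cos_aux n _ hn0 hp, sum_sin_aux n _ hn0 hp]
  split_ifs with h
  · subst h
    simp
    ring
  · have hq : ¬ ((n : ℤ) ∣ ((r : ℤ) - s)) := by
      intro h'
      have h3 : (n : ℤ) ≤ |(r : ℤ) - s| := Int.le_of_dvd (abs_pos.mpr (by omega)) ((dvd_abs _ _).mpr h')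
      rcases abs_cases ((r : ℤ) - s) with h4 | h4 <;> omega
    rw [sum_cos_aux n _ hn0 hq, sum_sin_aux n _ hn0 hq]
    simp

lemma sum_sq (R n : ℕ) (u v : ℕ → ℝ) (hn : 2 * R < n) :
    ∑ k ∈ Finset.range n, tAux R n u v k ^ 2 =
      n / 2 * ∑ r ∈ Finset.Icc 1 R, (u r ^ 2 + v r ^ 2) := by
  simp_rw [tAux, sq (Finset.sum _ _), Finset.sum_mul_sum]
  rw [Finset.sum_comm, Finset.mul_sum]
  refine Finset.sum_congr rfl fun r hr => ?_
  rw [Finset.sum_comm]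
  have hr' := Finset.mem_Icc.mp hr
  rw [Finset.sum_congr rfl (fun s hs => pair_sum n r s _ _ _ _ hr'.1 (Finset.mem_Icc.mp hs).1
    (by have := (Finset.mem_Icc.mp hs).2; omega))]
  rw [Finset.sum_ite_eq, if_pos hr]
  ring

lemma t_bound (R n : ℕ) (u v : ℕ → ℝ) (k : ℕ) :
    |tAux R n u v k| ≤ ∑ r ∈ Finset.Icc 1 R, (|u r| + |v r|) := by
  refine (Finset.abs_sum_le_sum_abs _ _).trans (Finset.sum_le_sum fun r _ => ?_)
  refine (abs_add_le _ _).trans ?_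
  rw [abs_mul, abs_mul]
  exact add_le_add (mul_le_of_le_one_right (abs_nonneg _) (Real.abs_sin_le_one _))
    (mul_le_of_le_one_right (abs_nonneg _) (Real.abs_cos_le_one _))

lemma phi_eq (R n : ℕ) (u v : ℕ → ℝ) :
    phi R n u v =
      ((∏ k ∈ Finset.range n, Real.cos (Real.sqrt (2 / n) * tAux R n u v k) : ℝ) : ℂ) := by
  rw [phi]
  have h1 : ∀ x : Fin n → ({-1, 1} : Finset ℝ), Complex.exp (Complex.I *
        (∑ r ∈ Finset.Icc 1 R,
          (u r * sCoef n (fun k => (x k : ℝ)) r +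
            v r * cCoef n (fun k => (x k : ℝ)) r) : ℝ)) =
      ∏ k : Fin n, Complex.exp (Complex.I *
        ((Real.sqrt (2 / n) * tAux R n u v k * (x k : ℝ) : ℝ) : ℂ)) := by
    intro x
    rw [← Complex.exp_sum, ← Finset.mul_sum, ← Complex.ofReal_sum]
    congr 3
    simp_rw [sCoef, cCoef, tAux, Finset.mul_sum, Finset.sum_mul, ← Finset.sum_add_distrib]
    rw [Finset.sum_comm]
    refine Finset.sum_congr rfl fun k _ => Finset.sum_congr rfl fun r _ => ?_
    ring
  simp_rw [h1]
  have h2 := Finset.prod_univ_sum (fun _ : Fin n => (Finset.univ : Finset ({-1, 1} : Finset ℝ)))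
    (fun k y => Complex.exp (Complex.I *
        ((Real.sqrt (2 / n) * tAux R n u v k * (y : ℝ) : ℝ) : ℂ)))
  rw [Fintype.piFinset_univ] at h2
  rw [← h2]
  have h3 : ∀ k : Fin n, ∑ y : ({-1, 1} : Finset ℝ), Complex.exp (Complex.I *
        ((Real.sqrt (2 / n) * tAux R n u v k * (y : ℝ) : ℝ) : ℂ)) =
        2 * ((Real.cos (Real.sqrt (2 / n) * tAux R n u v k) : ℝ) : ℂ) := by
    intro k
    rw [Finset.sum_coe_sort ({-1, 1} : Finset ℝ) (fun y => Complex.exp (Complex.I *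
        ((Real.sqrt (2 / n) * tAux R n u v k * y : ℝ) : ℂ))), Finset.sum_pair (by norm_num)]
    rw [Complex.ofReal_cos, Complex.two_cos, add_comm]
    congr 2
    · push_cast; ring
    · push_cast; ring
  simp_rw [h3]
  rw [Finset.prod_mul_distrib, Finset.prod_const, Finset.card_univ, Fintype.card_fin,
    mul_div_cancel_left₀ _ (pow_ne_zero _ two_ne_zero), Complex.ofReal_prod,
    Finset.prod_range (fun k => ((Real.cos (Real.sqrt (2 / n) * tAux R n u v k) : ℝ) : ℂ))]

lemma prod_diff (n : ℕ) (f g : ℕ → ℝ) (hf : ∀ k, |f k| ≤ 1) (hg : ∀ k, |g k| ≤ 1) :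
    |∏ k ∈ Finset.range n, f k - ∏ k ∈ Finset.range n, g k| ≤
      ∑ k ∈ Finset.range n, |f k - g k| := by
  induction n with
  | zero => simp
  | succ n ih =>
    rw [Finset.prod_range_succ, Finset.prod_range_succ, Finset.sum_range_succ]
    have hP : |∏ k ∈ Finset.range n, g k| ≤ 1 := by
      rw [Finset.abs_prod]
      exact Finset.prod_le_one (fun _ _ => abs_nonneg _) (fun k _ => hg k)
    have e : (∏ k ∈ Finset.range n, f k) * f n - (∏ k ∈ Finset.range n, g k) * g n =
      (∏ k ∈ Finset.range n, f k - ∏ k ∈ Finset.range n, g k) * f n +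
      (∏ k ∈ Finset.range n, g k) * (f n - g n) := by ring
    rw [e]
    refine (abs_add_le _ _).trans ?_
    rw [abs_mul, abs_mul]
    exact add_le_add ((mul_le_of_le_one_right (abs_nonneg _) (hf n)).trans ih)
      (mul_le_of_le_one_left (abs_nonneg _) hP)

lemma cos_exp_bound (a : ℝ) (ha : |a| ≤ 1) : |Real.cos a - Real.exp (-(a ^ 2 / 2))| ≤ a ^ 4 := by
  have h1 := Real.cos_bound ha
  have ha2 : a ^ 2 ≤ 1 := by rw [← sq_abs]; exact pow_le_one₀ (abs_nonneg _) ha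
  have h2 := Real.abs_exp_sub_one_sub_id_le (x := -(a ^ 2 / 2))
    (by rw [abs_neg, abs_of_nonneg (by positivity)]; linarith)
  have e4 : |a| ^ 4 = a ^ 4 := Even.pow_abs (by decide) a
  rw [e4] at h1
  have h4 : 0 ≤ a ^ 4 := by positivity
  have h5 : (-(a ^ 2 / 2)) ^ 2 = a ^ 4 / 4 := by ring
  rw [h5] at h2
  rw [abs_le] at *
  constructor <;> linarith [h1.1, h1.2, h2.1, h2.2]

/-- For every fixed `(u_1,v_1,…,u_R,v_R)`, the characteristic function `φ_n`
converges to `∏_{r=1}^R exp(−u_r²/2)·exp(−v_r²/2)` as `n → ∞`. -/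
theorem phi_tendsto_gaussian (R : ℕ) (hR : 0 < R) (u v : ℕ → ℝ) :
    Tendsto (fun n => phi R n u v) atTop
      (nhds (∏ r ∈ Finset.Icc 1 R,
        ((Real.exp (-(u r) ^ 2 / 2) * Real.exp (-(v r) ^ 2 / 2) : ℝ) : ℂ))) := by
  simp_rw [phi_eq]
  rw [← Complex.ofReal_prod]
  refine (Complex.continuous_ofReal.tendsto _).comp ?_
  set M : ℝ := ∑ r ∈ Finset.Icc 1 R, (|u r| + |v r|) with hM
  have hM0 : 0 ≤ M := Finset.sum_nonneg fun r _ => by positivity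
  have hL : ∏ r ∈ Finset.Icc 1 R, (Real.exp (-(u r) ^ 2 / 2) * Real.exp (-(v r) ^ 2 / 2)) =
      Real.exp (-((∑ r ∈ Finset.Icc 1 R, (u r ^ 2 + v r ^ 2)) / 2)) := by
    simp_rw [← Real.exp_add]
    rw [← Real.exp_sum, Finset.sum_div, ← Finset.sum_neg_distrib]
    congr 1
    exact Finset.sum_congr rfl fun r _ => by ring
  rw [hL]
  rw [tendsto_iff_norm_sub_tendsto_zero]
  have hlim : Tendsto (fun n : ℕ => (4 * M ^ 4) / (n : ℝ)) atTop (nhds 0) :=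
    tendsto_const_div_atTop_nhds_zero_nat _
  refine squeeze_zero' (Eventually.of_forall fun n => norm_nonneg _) ?_ hlim
  filter_upwards [eventually_gt_atTop (2 * R), eventually_ge_atTop ⌈2 * M ^ 2⌉₊] with n hn hnM
  have hn0 : (0 : ℝ) < n := by exact_mod_cast (by omega : 0 < n)
  have hnM' : 2 * M ^ 2 ≤ n := Nat.ceil_le.mp hnM
  have hsq : ∀ k, (Real.sqrt (2 / n) * tAux R n u v k) ^ 2 = 2 / n * tAux R n u v k ^ 2 := by
    intro k
    rw [mul_pow, Real.sq_sqrt (by positivity)]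
  have hb : ∀ k, (Real.sqrt (2 / n) * tAux R n u v k) ^ 2 ≤ 2 / n * M ^ 2 := by
    intro k
    rw [hsq, ← sq_abs (tAux R n u v k)]
    have := t_bound R n u v k
    gcongr
  have hE : Real.exp (-((∑ r ∈ Finset.Icc 1 R, (u r ^ 2 + v r ^ 2)) / 2)) =
      ∏ k ∈ Finset.range n, Real.exp (-((Real.sqrt (2 / n) * tAux R n u v k) ^ 2 / 2)) := by
    rw [← Real.exp_sum, Finset.sum_neg_distrib, ← Finset.sum_div]
    simp_rw [hsq]
    rw [← Finset.mul_sum, sum_sq R n u v hn]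
    congr 3
    field_simp
  rw [hE, Real.norm_eq_abs]
  refine (prod_diff n (fun k => Real.cos (Real.sqrt (2 / n) * tAux R n u v k))
    (fun k => Real.exp (-((Real.sqrt (2 / n) * tAux R n u v k) ^ 2 / 2)))
    (fun k => Real.abs_cos_le_one _) (fun k => ?_)).trans ?_
  · rw [abs_of_pos (Real.exp_pos _), Real.exp_le_one_iff]
    exact neg_nonpos.mpr (by positivity)
  · have hterm : ∀ k ∈ Finset.range n, |Real.cos (Real.sqrt (2 / n) * tAux R n u v k) -
        Real.exp (-((Real.sqrt (2 / n) * tAux R n u v k) ^ 2 / 2))| ≤ (2 / n * M ^ 2) ^ 2 := by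
      intro k _
      refine (cos_exp_bound _ ?_).trans ?_
      · rw [← sq_le_one_iff_abs_le_one]
        refine (hb k).trans ?_
        rw [div_mul_eq_mul_div, div_le_one hn0]
        exact hnM'
      · calc (Real.sqrt (2 / n) * tAux R n u v k) ^ 4
            = ((Real.sqrt (2 / n) * tAux R n u v k) ^ 2) ^ 2 := by ring
          _ ≤ _ := pow_le_pow_left₀ (by positivity) (hb k) 2
    refine (Finset.sum_le_sum hterm).trans (le_of_eq ?_)
    rw [Finset.sum_const, Finset.card_range, nsmul_eq_mul]
    field_simp
    ring
end
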